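/- If G is a subgraph of a finite undirected graph H, then the entanglement of G is at most the entanglement of H, i.e. Ent(G) ≤ Ent(H). -/

import Mathlib

/-!
The entanglement game `Ent(G,k)` on a graph with adjacency relation
`E : V → V → Prop` is played by Robber against `k` cops.  Positions are
`(v, C, P)` with `v : V`, `C : Finset V` with `C.card ≤ k`, and
`P ∈ {Cops, Robber}`.  Initially Robber chooses `v₀` and moves to
`(v₀, ∅, Cops)`.  From `(v, C, Cops)`, Cops may skip, add a cop on `v`
(if at most `k` cops are then placed), or move a placed cop to `v`; from
`(v, C, Robber)`, Robber moves along an edge to a vertex free of cops.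
Every finite play is a win for Cops, so "Cops have a winning strategy from
`(v, C, Cops)`" is the inductive predicate `EntCopsWinFrom`.  The
entanglement of the graph is the least `k` such that Cops have a winning
strategy in `Ent(G,k)` (it is at most the number of vertices).
-/

variable {V : Type*} [DecidableEq V]

/-- A legal Cops move in the game `Ent(G,k)`: from position `(v, C, Cops)`
Cops may go to `(v, C', Robber)` where `C'` is `C` (skip), `C ∪ {v}` provided
at most `k` cops are used (add), or `(C \ {x}) ∪ {v}` for some `x ∈ C`
(move a placed cop). -/
def EntCopsMove (k : ℕ) (v : V) (C C' : Finset V) : Prop :=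
  C' = C ∨ (C' = insert v C ∧ (insert v C).card ≤ k) ∨
    ∃ x ∈ C, C' = insert v (C.erase x)

/-- Cops have a winning strategy in `Ent(G,k)` from position `(v, C, Cops)`. -/
inductive EntCopsWinFrom (E : V → V → Prop) (k : ℕ) : V → Finset V → Prop
  | step (v : V) (C C' : Finset V) (hmove : EntCopsMove k v C C')
      (h : ∀ v', E v v' → v' ∉ C' → EntCopsWinFrom E k v' C') :
      EntCopsWinFrom E k v C

/-- Cops have a winning strategy in the game `Ent(G,k)`. -/
def EntCopsWin (E : V → V → Prop) (k : ℕ) : Prop :=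
  ∀ v : V, EntCopsWinFrom E k v ∅

/-- The entanglement of a graph: the least number `k` of cops such that Cops
have a winning strategy in the game `Ent(G,k)`. -/
noncomputable def entanglement (E : V → V → Prop) : ℕ :=
  sInf {k | EntCopsWin E k}

theorem EntCopsMove.card_le {V : Type*} [DecidableEq V] {k : ℕ} {v : V} {C C' : Finset V}
    (hmove : EntCopsMove k v C C') (hC : C.card ≤ k) : C'.card ≤ k := by
  rcases hmove with rfl | ⟨rfl, h⟩ | ⟨x, hx, rfl⟩
  · exact hC
  · exact h
  · have h₁ := Finset.card_insert_le v (C.erase x)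
    have h₂ := Finset.card_erase_add_one hx
    omega

theorem Finset.card_preimage_le_card {V W : Type*} [DecidableEq V] {f : W → V}
    (hf : Function.Injective f) (C : Finset V) : (C.preimage f hf.injOn).card ≤ C.card := by
  rw [← Finset.card_image_of_injective _ hf]
  refine Finset.card_le_card (Finset.image_subset_iff.mpr fun w hw => ?_)
  exact Finset.mem_preimage.mp hw

theorem Finset.preimage_insert_apply {V W : Type*} [DecidableEq V] [DecidableEq W] {f : W → V}
    (hf : Function.Injective f) (w : W) (C : Finset V) :
    (insert (f w) C).preimage f hf.injOn = insert w (C.preimage f hf.injOn) := by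
  ext u
  simp [hf.eq_iff]

/-- A Cops move pulls back along an injective map, a cop outside the range counting as unplaced. -/
theorem EntCopsMove.preimage {V W : Type*} [DecidableEq V] [DecidableEq W] {f : W → V}
    (hf : Function.Injective f) {k : ℕ} {w : W} {C C' : Finset V}
    (hmove : EntCopsMove k (f w) C C') (hC : C.card ≤ k) :
    EntCopsMove k w (C.preimage f hf.injOn) (C'.preimage f hf.injOn) := by
  have hcard := (Finset.card_preimage_le_card hf C').trans (hmove.card_le hC)
  rcases hmove with rfl | ⟨rfl, -⟩ | ⟨x, hx, rfl⟩
  · exact Or.inl rfl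
  · rw [Finset.preimage_insert_apply hf] at hcard ⊢
    exact Or.inr (Or.inl ⟨rfl, hcard⟩)
  · rw [Finset.preimage_insert_apply hf] at hcard ⊢
    by_cases hr : ∃ u, f u = x
    · obtain ⟨u, rfl⟩ := hr
      refine Or.inr (Or.inr ⟨u, by simpa using hx, ?_⟩)
      congr 1
      ext y
      simp [hf.eq_iff]
    · have he : (C.erase x).preimage f hf.injOn = C.preimage f hf.injOn := by
        ext y
        have hy : f y ≠ x := fun h => hr ⟨y, h⟩
        simp [hy]
      rw [he] at hcard ⊢
      exact Or.inr (Or.inl ⟨rfl, hcard⟩)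

theorem EntCopsWinFrom.preimage {V W : Type*} [DecidableEq V] [DecidableEq W]
    {E : V → V → Prop} {E' : W → W → Prop} {f : W → V} (hf : Function.Injective f)
    (hE : ∀ a b, E' a b → E (f a) (f b)) {k : ℕ} {v : V} {C : Finset V}
    (h : EntCopsWinFrom E k v C) (hC : C.card ≤ k) {w : W} (hw : f w = v) :
    EntCopsWinFrom E' k w (C.preimage f hf.injOn) := by
  induction h generalizing w with
  | step v C C' hmove _ ih =>
    subst hw
    refine .step _ _ (C'.preimage f hf.injOn) (hmove.preimage hf hC) fun w' hadj hmem => ?_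
    exact ih (f w') (hE _ _ hadj) (by simpa using hmem) (hmove.card_le hC) rfl

theorem EntCopsWin.of_injective {V W : Type*} [DecidableEq V] [DecidableEq W]
    {E : V → V → Prop} {E' : W → W → Prop} {f : W → V} (hf : Function.Injective f)
    (hE : ∀ a b, E' a b → E (f a) (f b)) {k : ℕ} (h : EntCopsWin E k) : EntCopsWin E' k := by
  intro w
  simpa using (h (f w)).preimage hf hE (by simp) rfl

/-- With one cop per vertex, Cops win by placing a cop on every vertex Robber visits. -/
theorem entCopsWinFrom_card {V : Type*} [Fintype V] [DecidableEq V] (E : V → V → Prop)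
    (v : V) (C : Finset V) (hv : v ∉ C) : EntCopsWinFrom E (Fintype.card V) v C := by
  refine .step _ _ (insert v C) (Or.inr (Or.inl ⟨rfl, Finset.card_le_univ _⟩)) fun v' _ hv' => ?_
  exact entCopsWinFrom_card E v' (insert v C) hv'
termination_by Fintype.card V - C.card
decreasing_by
  have h₁ := Finset.card_insert_of_notMem hv
  have h₂ := Finset.card_le_univ (insert v C)
  omega

theorem entCopsWin_entanglement {V : Type*} [Fintype V] [DecidableEq V] (E : V → V → Prop) :
    EntCopsWin E (entanglement E) :=
  Nat.sInf_mem (s := {k | EntCopsWin E k})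
    ⟨Fintype.card V, fun v => entCopsWinFrom_card E v ∅ (Finset.notMem_empty v)⟩

/-- If `G` is a subgraph of a finite undirected graph `H`, then
`Ent(G) ≤ Ent(H)`. -/
theorem entanglement_subgraph_le {V : Type*} [Fintype V] [DecidableEq V]
    (H : SimpleGraph V) (G : H.Subgraph) [Fintype ↥G.verts] :
    entanglement G.coe.Adj ≤ entanglement H.Adj :=
  Nat.sInf_le ((entCopsWin_entanglement H.Adj).of_injective Subtype.val_injective
    fun _ _ hadj => G.adj_sub hadj)
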